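/- arXiv:2008.03598 — 2 statements merged into one kernel-verified Lean document; each statement's English description precedes it below -/
import Mathlib

section
/- There is a constant C, depending only on ψ, ψ₁, ψ₂, such that for every h ∈ (0,1], γ ∈ (0,1], x,a > 0 and y,b,t,s ∈ ℝ, and for either sign, |G^±_{h,γ}((x,y,t),(a,b,s))| ≤ C √γ / h². -/
open Real Complex Filter MeasureTheory

/-- The normalized eigenfunctions
`e_k(x,θ) = θ^{1/3} Ai(θ^{2/3}x − ω_k) / (∫₀^∞ Ai(x'−ω_k)² dx')^{1/2}`. -/
noncomputable def ek (Ai : ℂ → ℂ) (ω : ℕ → ℝ) (k : ℕ) (θ x : ℝ) : ℂ :=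
  ((θ ^ ((1:ℝ)/3) : ℝ) : ℂ) * Ai ((θ ^ ((2:ℝ)/3) * x - ω k : ℝ)) /
    ((Real.sqrt (∫ x' in Set.Ioi (0:ℝ), (Ai ((x' - ω k : ℝ))).re ^ 2) : ℝ) : ℂ)

/-- The eigenvalues `λ_k(θ) = θ² + ω_k θ^{4/3}`. -/
noncomputable def lamk (ω : ℕ → ℝ) (k : ℕ) (θ : ℝ) : ℝ :=
  θ ^ 2 + ω k * θ ^ ((4:ℝ)/3)

/-- The phase-space localized half-wave Green kernel `G^±_{h,γ}`. -/
noncomputable def GreenKernel (Ai : ℂ → ℂ) (ω : ℕ → ℝ) (ψ ψ₁ ψ₂ : ℝ → ℝ)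
    (sgn h γ x y t a b s : ℝ) : ℂ :=
  ∑' k : ℕ, ((1/h : ℝ) : ℂ) * ∫ η : ℝ,
    Complex.exp (Complex.I * ((sgn * (t - s) * Real.sqrt (lamk ω (k+1) (η/h)) : ℝ) : ℂ)) *
    Complex.exp (Complex.I * (((y - b) * η / h : ℝ) : ℂ)) *
    ((ψ η * ψ₁ (h * Real.sqrt (lamk ω (k+1) (η/h)))
        * ψ₂ (h ^ ((2:ℝ)/3) * ω (k+1) / (η ^ ((2:ℝ)/3) * γ)) : ℝ) : ℂ) *
    ek Ai ω (k+1) (η/h) x * ek Ai ω (k+1) (η/h) a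

/-- The Liouville–Green amplitude of a solution `v` of `v'' = -z v`, in terms of `v` and `dv = v'`. -/
noncomputable def airyAmplitude (v dv : ℝ → ℝ) (z : ℝ) : ℝ :=
  √z * v z ^ 2 + (dv z + v z / (4 * z)) ^ 2 / √z

theorem two_mul_abs_le_airyAmplitude (v dv : ℝ → ℝ) {z : ℝ} (hz : 0 < z) :
    2 * |v z * (dv z + v z / (4 * z))| ≤ airyAmplitude v dv z := by
  have hq : 0 < √z := Real.sqrt_pos.2 hz
  unfold airyAmplitude
  generalize dv z + v z / (4 * z) = y
  generalize √z = q at *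
  have e : q * v z ^ 2 + y ^ 2 / q = ((q * |v z|) ^ 2 + |y| ^ 2) / q := by
    rw [mul_pow, sq_abs, sq_abs]; field_simp
  rw [e, le_div_iff₀ hq, abs_mul]
  nlinarith [sq_nonneg (q * |v z| - |y|)]

theorem hasDerivAt_airyAmplitude {v dv : ℝ → ℝ} (hv : ∀ z, HasDerivAt v (dv z) z)
    (hdv : ∀ z, HasDerivAt dv (-z * v z) z) {z : ℝ} (hz : 0 < z) :
    HasDerivAt (airyAmplitude v dv)
      (-(5 / 8) * (v z * (dv z + v z / (4 * z))) / (z ^ 2 * √z)) z := by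
  have hq : 0 < √z := Real.sqrt_pos.2 hz
  have hs := Real.hasDerivAt_sqrt hz.ne'
  have h4 : HasDerivAt (fun z : ℝ => 4 * z) 4 z := by
    simpa using (hasDerivAt_id z).const_mul (4 : ℝ)
  have h := (hs.mul ((hv z).pow 2)).add
    ((((hdv z).add ((hv z).div h4 (by positivity))).pow 2).div hs hq.ne')
  refine h.congr_deriv ?_
  have hz2 : z = √z ^ 2 := (Real.sq_sqrt hz.le).symm
  simp only [Pi.add_apply, Pi.div_apply, Pi.pow_apply]
  generalize v z = a at *
  generalize dv z = b at *
  generalize √z = q at *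
  subst hz2
  simp only [Nat.reduceSub, pow_one, Nat.cast_ofNat]
  field_simp
  ring

/-- The amplitude of a solution of `v'' = -z v` stays comparable to its initial value. -/
theorem airyAmplitude_bounds {v dv : ℝ → ℝ} (hv : ∀ z, HasDerivAt v (dv z) z)
    (hdv : ∀ z, HasDerivAt dv (-z * v z) z) {z₀ : ℝ} (hz₀ : 0 < z₀) :
    ∃ c > 0, ∃ C > 0, ∀ z, z₀ ≤ z → c * airyAmplitude v dv z₀ ≤ airyAmplitude v dv z ∧
      airyAmplitude v dv z ≤ C * airyAmplitude v dv z₀ := by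
  set W := airyAmplitude v dv with hW
  obtain ⟨κ, hκ⟩ : ∃ κ : ℝ, κ = 5 / 16 / √z₀ := ⟨_, rfl⟩
  have hq₀ : 0 < √z₀ := Real.sqrt_pos.2 hz₀
  have hκ0 : 0 < κ := by rw [hκ]; positivity
  have hW0 : ∀ z, 0 < z → 0 ≤ W z := fun z hz => by
    have := two_mul_abs_le_airyAmplitude v dv hz
    exact (by positivity : (0 : ℝ) ≤ _).trans this
  have hbd : ∀ z, z₀ ≤ z →
      |-(5 / 8) * (v z * (dv z + v z / (4 * z))) / (z ^ 2 * √z)| ≤ κ / z ^ 2 * W z := by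
    intro z hz
    have hz' : 0 < z := hz₀.trans_le hz
    have hq : 0 < √z := Real.sqrt_pos.2 hz'
    have h1 := two_mul_abs_le_airyAmplitude v dv hz'
    have h2 : √z₀ ≤ √z := Real.sqrt_le_sqrt hz
    rw [abs_div, abs_mul, abs_of_pos (by positivity : 0 < z ^ 2 * √z)]
    have h3 : |(-(5 / 8) : ℝ)| = 5 / 8 := by norm_num [abs_of_neg]
    rw [h3]
    calc _ ≤ (5 / 16 * W z) / (z ^ 2 * √z₀) := by
          have := hW0 z hz'
          refine div_le_div₀ (by positivity) ?_ (by positivity) (by gcongr)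
          linarith
      _ = _ := by rw [hκ]; field_simp
  have hexp : ∀ σ z : ℝ, 0 < z → HasDerivAt (fun z => Real.exp (σ / z))
      (Real.exp (σ / z) * (-(σ / z ^ 2))) z := by
    intro σ z hz
    have := ((hasDerivAt_inv hz.ne').const_mul σ).exp
    refine (this.congr_deriv ?_)
    rw [div_eq_mul_inv, div_eq_mul_inv]; ring
  have hd : ∀ σ z : ℝ, 0 < z → HasDerivAt (fun z => W z * Real.exp (σ / z)) _ z :=
    fun σ z hz => (hasDerivAt_airyAmplitude hv hdv hz).mul (hexp σ z hz)
  have hc : ∀ σ : ℝ, ContinuousOn (fun z => W z * Real.exp (σ / z)) (Set.Ici z₀) :=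
    fun σ z hz => (hd σ z (hz₀.trans_le hz)).continuousAt.continuousWithinAt
  have hup : AntitoneOn (fun z => W z * Real.exp (κ / z)) (Set.Ici z₀) := by
    refine antitoneOn_of_hasDerivWithinAt_nonpos (convex_Ici z₀) (hc κ)
      (fun z hz => (hd κ z ?_).hasDerivWithinAt) (fun z hz => ?_)
    · rw [interior_Ici] at hz; exact hz₀.trans hz
    · rw [interior_Ici] at hz
      have := (abs_le.1 (hbd z (le_of_lt hz))).2
      nlinarith [Real.exp_pos (κ / z)]
  have hlo : MonotoneOn (fun z => W z * Real.exp (-κ / z)) (Set.Ici z₀) := by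
    refine monotoneOn_of_hasDerivWithinAt_nonneg (convex_Ici z₀) (hc (-κ))
      (fun z hz => (hd (-κ) z ?_).hasDerivWithinAt) (fun z hz => ?_)
    · rw [interior_Ici] at hz; exact hz₀.trans hz
    · rw [interior_Ici] at hz
      have := (abs_le.1 (hbd z (le_of_lt hz))).1
      have e : -κ / z ^ 2 = -(κ / z ^ 2) := by ring
      rw [e]
      nlinarith [Real.exp_pos (-κ / z)]
  refine ⟨Real.exp (-κ / z₀), Real.exp_pos _, Real.exp (κ / z₀), Real.exp_pos _,
    fun z hz => ⟨?_, ?_⟩⟩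
  · have h1 := hlo Set.self_mem_Ici hz hz
    have hz' : 0 < z := hz₀.trans_le hz
    have h2 : Real.exp (-κ / z) ≤ 1 := Real.exp_le_one_iff.2 (by
      rw [neg_div]; exact neg_nonpos.2 (by positivity))
    have h3 := mul_le_mul_of_nonneg_left h2 (hW0 z hz')
    simp only at h1
    linarith
  · have h1 := hup Set.self_mem_Ici hz hz
    have hz' : 0 < z := hz₀.trans_le hz
    have h2 : 1 ≤ Real.exp (κ / z) := Real.one_le_exp (by positivity)
    have h3 := mul_le_mul_of_nonneg_left h2 (hW0 z hz')
    simp only at h1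
    linarith

theorem sq_le_of_oscillatory {v dv : ℝ → ℝ} (hv : ∀ z, HasDerivAt v (dv z) z)
    (hdv : ∀ z, HasDerivAt dv (-z * v z) z) :
    ∃ C > 0, ∀ z, 0 ≤ z → v z ^ 2 ≤ C / √(1 + z) := by
  obtain ⟨_, _, C, hC, h⟩ := airyAmplitude_bounds hv hdv one_pos
  have hcont : Continuous v := continuous_iff_continuousAt.2 fun z => (hv z).continuousAt
  obtain ⟨B, hB⟩ := (isCompact_Icc (a := (0 : ℝ)) (b := 1)).exists_bound_of_continuousOn
    hcont.continuousOn
  have hW1 : 0 ≤ airyAmplitude v dv 1 :=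
    (by positivity : (0 : ℝ) ≤ _).trans (two_mul_abs_le_airyAmplitude v dv one_pos)
  refine ⟨2 * (B ^ 2 + C * airyAmplitude v dv 1 + 1), by positivity, fun z hz => ?_⟩
  rw [le_div_iff₀ (by positivity)]
  rcases le_total z 1 with hz1 | hz1
  · have h1 : v z ^ 2 ≤ B ^ 2 := sq_le_sq' (neg_le_of_abs_le (hB z ⟨hz, hz1⟩))
      (le_of_abs_le (hB z ⟨hz, hz1⟩))
    have h2 : √(1 + z) ≤ 2 := Real.sqrt_le_iff.2 ⟨by norm_num, by linarith⟩
    have h3 : 0 ≤ C * airyAmplitude v dv 1 := by positivity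
    nlinarith [Real.sqrt_nonneg (1 + z), sq_nonneg (v z)]
  · have h1 := (h z hz1).2
    have h2 : √(1 + z) ≤ 2 * √z := Real.sqrt_le_iff.2 ⟨by positivity, by
      rw [mul_pow, Real.sq_sqrt hz]; linarith⟩
    have h3 : √z * v z ^ 2 ≤ airyAmplitude v dv z := by
      unfold airyAmplitude
      have : 0 ≤ (dv z + v z / (4 * z)) ^ 2 / √z := by positivity
      linarith
    nlinarith [sq_nonneg (v z), sq_nonneg B]

theorem one_le_sub_sq_mul_of_zeros {v dv : ℝ → ℝ} (hv : ∀ z, HasDerivAt v (dv z) z)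
    (hdv : ∀ z, HasDerivAt dv (-z * v z) z) {α β : ℝ} (hα : 0 < α) (hβ : v β = 0) (hα' : v α = 0)
    {t : ℝ} (ht : t ∈ Set.Icc α β) (hvt : v t ≠ 0) :
    1 ≤ (β - α) ^ 2 * β := by
  have hcont : Continuous v := continuous_iff_continuousAt.2 fun z => (hv z).continuousAt
  have hαβ : α ≤ β := ht.1.trans ht.2
  obtain ⟨m, hm, hmax⟩ := isCompact_Icc.exists_isMaxOn (Set.nonempty_Icc.2 hαβ)
    (hcont.pow 2).continuousOn
  have hle : ∀ z ∈ Set.Icc α β, |v z| ≤ |v m| := fun z hz => sq_le_sq.1 (hmax hz)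
  have hpos : 0 < |v m| := (abs_pos.2 hvt).trans_le (hle t ht)
  have hvm : v m ≠ 0 := abs_pos.1 hpos
  have hmα : α < m := lt_of_le_of_ne hm.1 fun h => hvm (h ▸ hα')
  have hmβ : m < β := lt_of_le_of_ne hm.2 fun h => hvm (h.symm ▸ hβ)
  have hloc : IsLocalMax (fun z => v z ^ 2) m :=
    hmax.isLocalMax (Icc_mem_nhds hmα hmβ)
  have hdm : dv m = 0 := by
    have := hloc.hasDerivAt_eq_zero ((hv m).pow 2)
    simpa [hvm] using this
  have hsub : Set.Icc m β ⊆ Set.Icc α β := Set.Icc_subset_Icc_left hm.1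
  have h1 : ∀ z ∈ Set.Icc m β, |dv z| ≤ β * |v m| * (β - m) := by
    intro z hz
    have := (convex_Icc m β).norm_image_sub_le_of_norm_hasDerivWithin_le
      (f := dv) (C := β * |v m|) (fun z hz => (hdv z).hasDerivWithinAt) (fun z hz => by
        rw [Real.norm_eq_abs, abs_mul, abs_neg, abs_of_pos (by linarith [hz.1] : 0 < z)]
        exact mul_le_mul hz.2 (hle z (hsub hz)) (abs_nonneg _) (by linarith))
      (Set.left_mem_Icc.2 hmβ.le) hz
    rw [hdm, sub_zero, Real.norm_eq_abs, Real.norm_eq_abs, abs_of_nonneg (sub_nonneg.2 hz.1)]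
      at this
    refine this.trans (mul_le_mul_of_nonneg_left (by linarith [hz.2]) ?_)
    have : 0 < β := by linarith
    positivity
  have h2 := (convex_Icc m β).norm_image_sub_le_of_norm_hasDerivWithin_le
      (f := v) (fun z hz => (hv z).hasDerivWithinAt) h1
      (Set.left_mem_Icc.2 hmβ.le) (Set.right_mem_Icc.2 hmβ.le)
  rw [hβ, zero_sub, norm_neg, Real.norm_eq_abs, Real.norm_eq_abs,
    abs_of_pos (sub_pos.2 hmβ)] at h2
  have h3 : 1 ≤ (β - m) ^ 2 * β := by
    by_contra! hlt
    nlinarith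
  have h4 : (β - m) ^ 2 ≤ (β - α) ^ 2 := by nlinarith
  nlinarith

theorem sq_antitoneOn_of_integrableOn {u du : ℝ → ℝ} (hu : ∀ x, HasDerivAt u (du x) x)
    (hdu : ∀ x, HasDerivAt du (x * u x) x)
    (hint : IntegrableOn (fun x => u x ^ 2) (Set.Ioi 0)) :
    AntitoneOn (fun x => u x ^ 2) (Set.Ici 0) := by
  have hf : ∀ x, HasDerivAt (fun x => u x ^ 2) (2 * (u x * du x)) x := fun x =>
    ((hu x).pow 2).congr_deriv (by ring)
  have hg : ∀ x, HasDerivAt (fun x => u x * du x) (du x ^ 2 + x * u x ^ 2) x := fun x =>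
    ((hu x).mul (hdu x)).congr_deriv (by ring)
  have hmono : MonotoneOn (fun x => u x * du x) (Set.Ici 0) := by
    refine monotoneOn_of_hasDerivWithinAt_nonneg (convex_Ici 0)
      (fun x _ => (hg x).continuousAt.continuousWithinAt)
      (fun x _ => (hg x).hasDerivWithinAt) (fun x hx => ?_)
    rw [interior_Ici] at hx
    have : 0 < x := hx
    positivity
  have hneg : ∀ x, 0 ≤ x → u x * du x ≤ 0 := by
    intro x hx
    by_contra! hlt
    have hm2 : MonotoneOn (fun x => u x ^ 2) (Set.Ici x) := by
      refine monotoneOn_of_hasDerivWithinAt_nonneg (convex_Ici x)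
        (fun x _ => (hf x).continuousAt.continuousWithinAt)
        (fun x _ => (hf x).hasDerivWithinAt) (fun y hy => ?_)
      rw [interior_Ici] at hy
      have hy' : x < y := hy
      have := hmono (Set.mem_Ici.2 hx) (Set.mem_Ici.2 (hx.trans hy'.le)) hy'.le
      simp only at this
      linarith
    have hux : 0 < u x ^ 2 := by
      have : u x ≠ 0 := fun h => by simp [h] at hlt
      positivity
    have hI : IntegrableOn (fun _ : ℝ => u x ^ 2) (Set.Ioi x) := by
      refine Integrable.mono' (hint.mono_set (Set.Ioi_subset_Ioi hx)) (by fun_prop) ?_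
      filter_upwards [ae_restrict_mem measurableSet_Ioi] with y hy
      rw [Real.norm_eq_abs, abs_of_pos hux]
      exact hm2 Set.self_mem_Ici (Set.mem_Ici.2 (le_of_lt hy)) (le_of_lt hy)
    rw [integrableOn_const_iff] at hI
    simp at hI
    simp [hI] at hux
  refine antitoneOn_of_hasDerivWithinAt_nonpos (convex_Ici 0)
      (fun x _ => (hf x).continuousAt.continuousWithinAt)
      (fun x _ => (hf x).hasDerivWithinAt) (fun x hx => ?_)
  rw [interior_Ici] at hx
  linarith [hneg x (le_of_lt hx)]

theorem sq_le_of_integrableOn {u du : ℝ → ℝ} (hu : ∀ x, HasDerivAt u (du x) x)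
    (hdu : ∀ x, HasDerivAt du (x * u x) x)
    (hint : IntegrableOn (fun x => u x ^ 2) (Set.Ioi 0)) :
    ∃ C > 0, ∀ x, 0 ≤ x → u x ^ 2 ≤ C / √(1 + x) := by
  have hanti := sq_antitoneOn_of_integrableOn hu hdu hint
  have hI : 0 ≤ ∫ x in Set.Ioi (0 : ℝ), u x ^ 2 := integral_nonneg fun x => sq_nonneg _
  refine ⟨u 0 ^ 2 + (∫ x in Set.Ioi (0 : ℝ), u x ^ 2) + 1, by positivity, fun x hx => ?_⟩
  have h0 : u x ^ 2 ≤ u 0 ^ 2 := hanti Set.self_mem_Ici hx hx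
  have h1 : x * u x ^ 2 ≤ ∫ x in Set.Ioi (0 : ℝ), u x ^ 2 := by
    have hsub : Set.Ioc 0 x ⊆ Set.Ioi 0 := Set.Ioc_subset_Ioi_self
    calc x * u x ^ 2 = ∫ _ in Set.Ioc 0 x, u x ^ 2 := by simp [hx]
      _ ≤ ∫ y in Set.Ioc 0 x, u y ^ 2 :=
          setIntegral_mono_on (integrableOn_const (by simp)) (hint.mono_set hsub)
            measurableSet_Ioc fun y hy => hanti hy.1.le hx hy.2
      _ ≤ _ := setIntegral_mono_set hint (ae_of_all _ fun y => sq_nonneg _)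
            (ae_of_all _ hsub)
  rw [le_div_iff₀ (by positivity)]
  have h2 : √(1 + x) ≤ 1 + x := Real.sqrt_le_iff.2 ⟨by linarith, by nlinarith⟩
  nlinarith [sq_nonneg (u x)]

theorem sum_inv_sqrt_le {δ A : ℝ} (hδ : 0 < δ) (hA : 0 ≤ A) (S : Finset ℝ) :
    (∀ p ∈ S, ∀ q ∈ S, p < q → p + δ ≤ q) → ∀ B, A ≤ B → (∀ p ∈ S, A ≤ p ∧ p ≤ B) →
      ∑ p ∈ S, δ / √(1 + p) ≤ δ + 2 * (√(1 + B) - √(1 + A)) := by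
  induction S using Finset.induction_on_max with
  | empty =>
    intro _ B hB _
    have := Real.sqrt_le_sqrt (by linarith : 1 + A ≤ 1 + B)
    simp only [Finset.sum_empty]
    linarith
  | insert a S hmax ih =>
    intro hsep B hB hmem
    have ha := hmem a (Finset.mem_insert_self _ _)
    rw [Finset.sum_insert fun h => lt_irrefl _ (hmax a h)]
    have hBa := Real.sqrt_le_sqrt (by linarith : 1 + a ≤ 1 + B)
    rcases S.eq_empty_or_nonempty with rfl | ⟨p, hp⟩
    · have h1 := Real.sqrt_le_sqrt (by linarith : 1 + A ≤ 1 + B)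
      have h2 : δ / √(1 + a) ≤ δ := div_le_self hδ.le (Real.one_le_sqrt.2 (by linarith))
      simp only [Finset.sum_empty]
      linarith
    · have hle : ∀ q ∈ S, q ≤ a - δ := fun q hq => by
        have := hsep q (Finset.mem_insert_of_mem hq) a (Finset.mem_insert_self _ _) (hmax q hq)
        linarith
      have hAa : A ≤ a - δ := (hmem p (Finset.mem_insert_of_mem hp)).1.trans (hle p hp)
      have h1 := ih (fun p hp q hq => hsep p (Finset.mem_insert_of_mem hp) q
        (Finset.mem_insert_of_mem hq)) (a - δ) hAa
        fun q hq => ⟨(hmem q (Finset.mem_insert_of_mem hq)).1, hle q hq⟩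
      have h2 : δ / √(1 + a) ≤ 2 * (√(1 + a) - √(1 + (a - δ))) := by
        rw [div_le_iff₀ (Real.sqrt_pos.2 (by linarith))]
        have e1 := Real.sq_sqrt (by linarith : 0 ≤ 1 + a)
        have e2 := Real.sq_sqrt (by linarith : 0 ≤ 1 + (a - δ))
        nlinarith [sq_nonneg (√(1 + a) - √(1 + (a - δ)))]
      linarith

theorem sum_inv_sqrt_abs_le {R : ℝ} (hR : 0 < R) {X : ℝ} (hX : 0 ≤ X) (S : Finset ℝ)
    (hmem : ∀ p ∈ S, 0 ≤ p ∧ p ≤ R) (hsep : ∀ p ∈ S, ∀ q ∈ S, p < q → p + 1 / √R ≤ q) :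
    ∑ p ∈ S, 1 / √(1 + |X - p|) ≤ 2 + 4 * R := by
  have hq : 0 < √R := Real.sqrt_pos.2 hR
  have key : ∀ (T : Finset ℝ) (A B : ℝ), 0 ≤ A → A ≤ B → B ≤ A + R →
      (∀ p ∈ T, A ≤ p ∧ p ≤ B) → (∀ p ∈ T, ∀ q ∈ T, p < q → p + 1 / √R ≤ q) →
      ∑ p ∈ T, 1 / √(1 + p) ≤ 1 + 2 * R := by
    intro T A B hA hAB hBA hT hs
    have h1 := sum_inv_sqrt_le (one_div_pos.2 hq) hA T hs B hAB hT
    have h2 : √(1 + B) ≤ √(1 + A) + √R :=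
      Real.sqrt_le_iff.2 ⟨by positivity, by
        nlinarith [Real.sq_sqrt hR.le, Real.sq_sqrt (by linarith : 0 ≤ 1 + A),
          mul_nonneg (Real.sqrt_nonneg (1 + A)) hq.le]⟩
    have h3 : ∑ p ∈ T, 1 / √R / √(1 + p) = (∑ p ∈ T, 1 / √(1 + p)) / √R := by
      rw [Finset.sum_div]
      exact Finset.sum_congr rfl fun p _ => by rw [div_right_comm]
    rw [h3, div_le_iff₀ hq] at h1
    refine h1.trans ?_
    have h4 : 1 / √R * √R = 1 := by field_simp
    nlinarith [Real.sq_sqrt hR.le]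
  rw [← Finset.sum_filter_add_sum_filter_not S (fun p => X ≤ p)]
  have h1 : ∑ p ∈ S with X ≤ p, 1 / √(1 + |X - p|) ≤ 1 + 2 * R := by
    calc _ = ∑ q ∈ (S.filter (X ≤ ·)).image (· - X), 1 / √(1 + q) := by
          rw [Finset.sum_image fun _ _ _ _ h => sub_left_injective h]
          refine Finset.sum_congr rfl fun p hp => ?_
          rw [abs_sub_comm, abs_of_nonneg (sub_nonneg.2 (Finset.mem_filter.1 hp).2)]
      _ ≤ _ := by
          refine key _ 0 R le_rfl hR.le (by linarith) ?_ ?_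
          · simp only [Finset.forall_mem_image, Finset.mem_filter]
            intro p hp
            constructor <;> linarith [hp.2, (hmem p hp.1).2]
          · simp only [Finset.forall_mem_image, Finset.mem_filter]
            intro p hp q hq hpq
            linarith [hsep p hp.1 q hq.1 (by linarith)]
  have h2 : ∑ p ∈ S with ¬ X ≤ p, 1 / √(1 + |X - p|) ≤ 1 + 2 * R := by
    calc _ = ∑ q ∈ (S.filter (¬ X ≤ ·)).image (X - ·), 1 / √(1 + q) := by
          rw [Finset.sum_image fun _ _ _ _ h => sub_right_injective h]
          refine Finset.sum_congr rfl fun p hp => ?_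
          rw [abs_of_nonneg (sub_nonneg.2 (not_le.1 (Finset.mem_filter.1 hp).2).le)]
      _ ≤ _ := by
          refine key _ (max 0 (X - R)) X (le_max_left _ _) (max_le hX (by linarith))
            (by linarith [le_max_right 0 (X - R)]) ?_ ?_
          · simp only [Finset.forall_mem_image, Finset.mem_filter, not_le]
            intro p hp
            exact ⟨max_le (by linarith) (by linarith [(hmem p hp.1).2]),
              by linarith [(hmem p hp.1).1]⟩
          · simp only [Finset.forall_mem_image, Finset.mem_filter]
            intro p hp q hq hpq
            linarith [hsep q hq.1 p hp.1 (by linarith)]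
  linarith

theorem sum_norm_integral_le {α ι E : Type*} [MeasurableSpace α] {μ : Measure α}
    [NormedAddCommGroup E] [NormedSpace ℝ E] (K : Finset ι) (f : ι → α → E) {g : α → ℝ}
    (hg : Integrable g μ) (hfg : ∀ a, ∑ k ∈ K, ‖f k a‖ ≤ g a) :
    ∑ k ∈ K, ‖∫ a, f k a ∂μ‖ ≤ ∫ a, g a ∂μ := by
  classical
  have h1 : ∀ K : Finset ι, ∑ k ∈ K, ∫⁻ a, ‖f k a‖ₑ ∂μ ≤ ∫⁻ a, ∑ k ∈ K, ‖f k a‖ₑ ∂μ := by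
    intro K
    induction K using Finset.induction_on with
    | empty => simp
    | insert k K hk ih =>
      simp only [Finset.sum_insert hk]
      exact (add_le_add_right ih _).trans (le_lintegral_add _ _)
  have hg0 : ∀ a, 0 ≤ g a := fun a => (Finset.sum_nonneg fun _ _ => norm_nonneg _).trans (hfg a)
  rw [← ENNReal.ofReal_le_ofReal_iff (integral_nonneg hg0),
    ofReal_integral_eq_lintegral_ofReal hg (ae_of_all _ hg0),
    ENNReal.ofReal_sum_of_nonneg fun _ _ => norm_nonneg _]
  calc _ ≤ ∑ k ∈ K, ∫⁻ a, ‖f k a‖ₑ ∂μ := Finset.sum_le_sum fun k _ => by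
        rw [ofReal_norm]; exact enorm_integral_le_lintegral_enorm _
    _ ≤ ∫⁻ a, ∑ k ∈ K, ‖f k a‖ₑ ∂μ := h1 K
    _ ≤ _ := lintegral_mono fun a => by
        simp only [← ofReal_norm]
        rw [← ENNReal.ofReal_sum_of_nonneg fun _ _ => norm_nonneg _]
        exact ENNReal.ofReal_le_ofReal (hfg a)

theorem integral_sq_ge {v dv : ℝ → ℝ} (hv : ∀ z, HasDerivAt v (dv z) z)
    (hdv : ∀ z, HasDerivAt dv (-z * v z) z) {z₀ : ℝ} (hz₀ : 0 < z₀)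
    (hne : ∀ z ∈ Set.Ioo 0 z₀, v z ≠ 0) :
    ∃ c > 0, ∀ z, z₀ ≤ z → v z = 0 → c * √z ≤ ∫ y in (0 : ℝ)..z, v y ^ 2 := by
  have hcont : Continuous v := continuous_iff_continuousAt.2 fun z => (hv z).continuousAt
  have hii : ∀ a b : ℝ, IntervalIntegrable (fun y => v y ^ 2) volume a b :=
    fun a b => (hcont.pow 2).intervalIntegrable a b
  have hz₁ : 0 < z₀ / 2 := by positivity
  obtain ⟨c, hc, _, _, hW⟩ := airyAmplitude_bounds hv hdv hz₁
  set W₁ := airyAmplitude v dv (z₀ / 2) with hW₁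
  have hv₁ : v (z₀ / 2) ≠ 0 := hne _ ⟨hz₁, by linarith⟩
  have hW₁0 : 0 < W₁ := by
    rw [hW₁]; unfold airyAmplitude; positivity
  set J := ∫ y in (0 : ℝ)..z₀, v y ^ 2 with hJ
  have hJ0 : 0 < J := intervalIntegral.intervalIntegral_pos_of_pos_on (hii _ _)
    (fun z hz => by have := hne z hz; positivity) hz₀
  refine ⟨c * W₁ / (1 + dv 0 ^ 2 / J), by positivity, fun z hz hvz => ?_⟩
  have hz' : 0 < z := hz₀.trans_le hz
  have hq : 0 < √z := Real.sqrt_pos.2 hz'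
  have h1 : c * W₁ * √z ≤ dv z ^ 2 := by
    have := (hW z (by linarith)).1
    have e : airyAmplitude v dv z = dv z ^ 2 / √z := by simp [airyAmplitude, hvz]
    rwa [e, le_div_iff₀ hq] at this
  have h2 : ∫ y in (0 : ℝ)..z, v y ^ 2 = dv z ^ 2 - dv 0 ^ 2 := by
    have hd : ∀ y ∈ Set.uIcc 0 z, HasDerivAt (fun y => dv y ^ 2 + y * v y ^ 2) (v y ^ 2) y :=
      fun y _ => (((hdv y).pow 2).add ((hasDerivAt_id y).mul ((hv y).pow 2))).congr_deriv (by
        simp only [id, Pi.pow_apply]; ring)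
    rw [intervalIntegral.integral_eq_sub_of_hasDerivAt hd (hii _ _), hvz]
    ring
  have h3 : J ≤ ∫ y in (0 : ℝ)..z, v y ^ 2 :=
    intervalIntegral.integral_mono_interval le_rfl hz₀.le hz
      (ae_of_all _ fun y => sq_nonneg _) (hii _ _)
  generalize (∫ y in (0 : ℝ)..z, v y ^ 2) = I at *
  rw [div_mul_eq_mul_div, div_le_iff₀ (by positivity)]
  have h4 : dv 0 ^ 2 ≤ I * (dv 0 ^ 2 / J) := by
    rw [mul_div_assoc', le_div_iff₀ hJ0]
    nlinarith [sq_nonneg (dv 0)]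
  linarith

theorem norm_ek_sq {Ai : ℂ → ℂ} (hAi_real : ∀ x : ℝ, (Ai x).im = 0) (ω : ℕ → ℝ) (k : ℕ)
    {θ : ℝ} (hθ : 0 < θ) (x : ℝ) :
    ‖ek Ai ω k θ x‖ ^ 2 = θ ^ ((2:ℝ)/3) * (Ai (θ ^ ((2:ℝ)/3) * x - ω k : ℝ)).re ^ 2 /
      ∫ x' in Set.Ioi (0:ℝ), (Ai ((x' - ω k : ℝ))).re ^ 2 := by
  have h1 : ∀ y : ℝ, ‖Ai y‖ ^ 2 = (Ai y).re ^ 2 := fun y => by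
    rw [Complex.sq_norm, Complex.normSq_apply, hAi_real y]; ring
  have h2 : (θ ^ ((1:ℝ)/3)) ^ 2 = θ ^ ((2:ℝ)/3) := by
    rw [← Real.rpow_natCast, ← Real.rpow_mul hθ.le]; norm_num
  rw [ek, norm_div, norm_mul, div_pow, mul_pow, h1, Complex.norm_real, Complex.norm_real,
    Real.norm_eq_abs, Real.norm_eq_abs, sq_abs, sq_abs, h2,
    Real.sq_sqrt (integral_nonneg fun _ => sq_nonneg _)]

theorem integrableOn_Ioi_sub_iff (f : ℝ → ℝ) (w : ℝ) :
    IntegrableOn (fun x => f (x - w)) (Set.Ioi 0) ↔ IntegrableOn f (Set.Ioi (-w)) := by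
  have := (measurePreserving_sub_right (volume : Measure ℝ) w).integrableOn_comp_preimage
    (MeasurableEquiv.subRight w).measurableEmbedding (f := f) (s := Set.Ioi (-w))
  simpa [Function.comp_def] using this

theorem intervalIntegral_neg_le_integral_Ioi_sub {f : ℝ → ℝ} (hf : ∀ x, 0 ≤ f x) {w : ℝ}
    (hw : 0 ≤ w) (hint : IntegrableOn (fun x => f (x - w)) (Set.Ioi 0)) :
    ∫ y in (0 : ℝ)..w, f (-y) ≤ ∫ x in Set.Ioi (0 : ℝ), f (x - w) := by
  have e : ∫ y in (0 : ℝ)..w, f (-y) = ∫ x in (0 : ℝ)..w, f (x - w) := by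
    rw [intervalIntegral.integral_comp_neg, intervalIntegral.integral_comp_sub_right]
    simp
  rw [e, intervalIntegral.integral_of_le hw]
  exact setIntegral_mono_set hint (ae_of_all _ fun y => hf _)
    (ae_of_all _ Set.Ioc_subset_Ioi_self)

theorem sum_norm_ek_sq_le
    {Ai : ℂ → ℂ} (hAi_diff : Differentiable ℂ Ai) (hAi_diff' : Differentiable ℂ (deriv Ai))
    (hAi_ode : ∀ z : ℂ, deriv (deriv Ai) z = z * Ai z) (hAi_real : ∀ x : ℝ, (Ai x).im = 0)
    {ω : ℕ → ℝ} (hω_pos : 0 < ω 1) (hω_mono : StrictMonoOn ω {k | 1 ≤ k})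
    (hAi_zeros : ∀ x : ℝ, Ai x = 0 ↔ ∃ k : ℕ, 1 ≤ k ∧ x = -ω k) :
    ∃ C > 0, ∀ M > 0, ∀ K : Finset ℕ, (∀ k ∈ K, M / 4 ≤ ω (k + 1) ∧ ω (k + 1) ≤ 9 / 4 * M) →
      ∀ θ > 0, ∀ x, 0 ≤ x →
        ∑ k ∈ K, ‖ek Ai ω (k + 1) θ x‖ ^ 2 ≤ C * (θ ^ ((2:ℝ)/3) * √M) := by
  set u : ℝ → ℝ := fun x => (Ai x).re with hu_def
  set du : ℝ → ℝ := fun x => (deriv Ai x).re with hdu_def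
  have hu : ∀ x, HasDerivAt u (du x) x := fun x =>
    (hAi_diff x).hasDerivAt.real_of_complex
  have hdu : ∀ x, HasDerivAt du (x * u x) x := fun x => by
    have := (hAi_diff' x).hasDerivAt.real_of_complex
    rw [hAi_ode] at this
    simpa using this
  obtain ⟨v, hv_def⟩ : ∃ v : ℝ → ℝ, v = fun z => u (-z) := ⟨_, rfl⟩
  obtain ⟨dv, hdv_def⟩ : ∃ dv : ℝ → ℝ, dv = fun z => -du (-z) := ⟨_, rfl⟩
  have hv : ∀ z, HasDerivAt v (dv z) z := fun z => by
    rw [hv_def, hdv_def]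
    exact ((hu (-z)).comp z (hasDerivAt_neg z)).congr_deriv (by ring)
  have hdv : ∀ z, HasDerivAt dv (-z * v z) z := fun z => by
    rw [hv_def, hdv_def]
    exact ((hdu (-z)).comp z (hasDerivAt_neg z)).neg.congr_deriv (by ring)
  have hv0 : ∀ z, v z = 0 ↔ ∃ k : ℕ, 1 ≤ k ∧ z = ω k := fun z => by
    have h1 : v z = 0 ↔ Ai (-z : ℝ) = 0 := by
      rw [hv_def, Complex.ext_iff, hAi_real]; simp [hu_def]
    rw [h1, hAi_zeros]
    simp only [neg_inj]
  have hω_le : ∀ k, 1 ≤ k → ω 1 ≤ ω k := fun k hk =>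
    hω_mono.monotoneOn (by simp) hk hk
  have hωk : ∀ k, 1 ≤ k → 0 < ω k := fun k hk => hω_pos.trans_le (hω_le k hk)
  have hvω : ∀ k, 1 ≤ k → v (ω k) = 0 := fun k hk => (hv0 _).2 ⟨k, hk, rfl⟩
  have hsep : ∀ i j, 1 ≤ i → i < j → 1 ≤ (ω j - ω i) ^ 2 * ω j := by
    intro i j hi hij
    have h1 : ω i < ω (i + 1) := hω_mono hi (by simp) (Nat.lt_succ_self i)
    have h2 : ω (i + 1) ≤ ω j := hω_mono.monotoneOn (by simp) (by simp; omega) hij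
    refine one_le_sub_sq_mul_of_zeros hv hdv (hωk i hi) (hvω j (by omega)) (hvω i hi)
      (t := (ω i + ω (i + 1)) / 2) ⟨by linarith, by linarith⟩ ?_
    rw [Ne, hv0]
    rintro ⟨k, hk, hk'⟩
    have h3 : i < k := (hω_mono.lt_iff_lt hi hk).1 (by linarith)
    have h4 : k < i + 1 := (hω_mono.lt_iff_lt hk (by simp)).1 (by linarith)
    omega
  have hinj : ∀ i j, ω (i + 1) < ω (j + 1) → i < j := fun i j h => by
    have := (hω_mono.lt_iff_lt (by simp) (by simp)).1 h
    omega
  by_cases hP : ∃ k, IntegrableOn (fun x => u (x - ω (k + 1)) ^ 2) (Set.Ioi 0)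
  swap
  · refine ⟨1, one_pos, fun M hM K _ θ hθ x _ => ?_⟩
    rw [Finset.sum_eq_zero]
    · positivity
    · intro k _
      rw [norm_ek_sq hAi_real ω _ hθ, integral_undef fun h => hP ⟨k, h⟩, div_zero]
  obtain ⟨k₀, hk₀⟩ := hP
  have hint : IntegrableOn (fun x => u x ^ 2) (Set.Ioi 0) :=
    ((integrableOn_Ioi_sub_iff (fun x => u x ^ 2) _).1 hk₀).mono_set
      (Set.Ioi_subset_Ioi (by linarith [hωk (k₀ + 1) (by omega)]))
  obtain ⟨C₁, hC₁, hdecay⟩ := sq_le_of_integrableOn hu hdu hint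
  obtain ⟨C₂, hC₂, hosc⟩ := sq_le_of_oscillatory hv hdv
  have hbound : ∀ x, u x ^ 2 ≤ (C₁ + C₂) * (1 / √(1 + |x|)) := by
    intro x
    rw [mul_one_div]
    rcases le_total 0 x with hx | hx
    · rw [abs_of_nonneg hx]
      refine (hdecay x hx).trans ?_
      gcongr; linarith
    · rw [abs_of_nonpos hx]
      have := hosc (-x) (by linarith)
      simp only [hv_def, neg_neg] at this
      refine this.trans ?_
      gcongr; linarith
  obtain ⟨c, hc, hnorm⟩ := integral_sq_ge hv hdv hω_pos (fun z hz h => by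
    obtain ⟨k, hk, rfl⟩ := (hv0 z).1 h
    exact absurd hz.2 (hω_le k hk).not_gt)
  set D := C₁ + C₂ with hD
  refine ⟨2 / c * D * (2 * (9 / 4) / ω 1 + 9), by positivity, fun M hM K hK θ hθ x hx => ?_⟩
  have hM' : 0 < √M := Real.sqrt_pos.2 hM
  have hterm : ∀ k ∈ K, ‖ek Ai ω (k + 1) θ x‖ ^ 2 ≤ θ ^ ((2:ℝ)/3) *
      (2 / (c * √M)) * (D * (1 / √(1 + |θ ^ ((2:ℝ)/3) * x - ω (k + 1)|))) := by
    intro k hk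
    rw [norm_ek_sq hAi_real ω _ hθ]
    have h0 := hbound (θ ^ ((2:ℝ)/3) * x - ω (k + 1))
    by_cases hik : IntegrableOn (fun x => u (x - ω (k + 1)) ^ 2) (Set.Ioi 0)
    · have h1 := hnorm _ (hω_le (k + 1) (by omega)) (hvω (k + 1) (by omega))
      have h2 := intervalIntegral_neg_le_integral_Ioi_sub (f := fun x => u x ^ 2)
        (fun _ => sq_nonneg _) (hωk (k + 1) (by omega)).le hik
      have h3 : √M / 2 ≤ √(ω (k + 1)) := by
        refine Real.le_sqrt_of_sq_le ?_
        rw [div_pow, Real.sq_sqrt hM.le]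
        linarith [(hK k hk).1]
      have h4 : c * (√M / 2) ≤ ∫ x in Set.Ioi (0 : ℝ), u (x - ω (k + 1)) ^ 2 := by
        rw [hv_def] at h1
        exact (mul_le_mul_of_nonneg_left h3 hc.le).trans (h1.trans h2)
      calc _ ≤ θ ^ ((2:ℝ)/3) * (D * (1 / √(1 + |θ ^ ((2:ℝ)/3) * x - ω (k + 1)|))) /
            (c * (√M / 2)) := by
            refine div_le_div₀ (by positivity) ?_ (by positivity) h4
            exact mul_le_mul_of_nonneg_left h0 (by positivity)
        _ = _ := by field_simp
    · rw [integral_undef hik, div_zero]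
      positivity
  rcases K.eq_empty_or_nonempty with rfl | ⟨k₁, hk₁⟩
  · simp only [Finset.sum_empty]; positivity
  have hMω : ω 1 ≤ 9 / 4 * M := (hω_le (k₁ + 1) (by omega)).trans (hK k₁ hk₁).2
  have hR : 0 < 9 / 4 * M := by positivity
  have hsum : ∑ k ∈ K, 1 / √(1 + |θ ^ ((2:ℝ)/3) * x - ω (k + 1)|) ≤ 2 + 4 * (9 / 4 * M) := by
    rw [← Finset.sum_image (f := fun p => 1 / √(1 + |θ ^ ((2:ℝ)/3) * x - p|))
      (g := fun k => ω (k + 1)) (s := K)]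
    · refine sum_inv_sqrt_abs_le hR (by positivity) _ ?_ ?_
      · simp only [Finset.forall_mem_image]
        exact fun k hk => ⟨(hωk _ (by omega)).le, (hK k hk).2⟩
      · simp only [Finset.forall_mem_image]
        intro i hi j hj hij
        have h1 := hsep (i + 1) (j + 1) (by omega) (by have := hinj i j hij; omega)
        have h2 : 1 ≤ (ω (j + 1) - ω (i + 1)) ^ 2 * (9 / 4 * M) :=
          h1.trans (mul_le_mul_of_nonneg_left (hK j hj).2 (sq_nonneg _))
        have h3 : 1 / √(9 / 4 * M) ≤ ω (j + 1) - ω (i + 1) := by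
          rw [← Real.sqrt_one, ← Real.sqrt_div zero_le_one, Real.sqrt_le_left (by linarith),
            div_le_iff₀ hR]
          exact h2
        linarith
    · intro i _ j _ hij
      by_contra hne
      rcases lt_or_gt_of_ne hne with h | h
      · exact (hω_mono (by simp) (by simp) (Nat.succ_lt_succ h)).ne hij
      · exact (hω_mono (by simp) (by simp) (Nat.succ_lt_succ h)).ne' hij
  have hsum' : 2 + 4 * (9 / 4 * M) ≤ (2 * (9 / 4) / ω 1 + 9) * M := by
    have : 2 ≤ 2 * (9 / 4) / ω 1 * M := by
      rw [div_mul_eq_mul_div, le_div_iff₀ hω_pos]; linarith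
    linarith
  calc _ ≤ ∑ k ∈ K, θ ^ ((2:ℝ)/3) *
      (2 / (c * √M)) * (D * (1 / √(1 + |θ ^ ((2:ℝ)/3) * x - ω (k + 1)|))) :=
        Finset.sum_le_sum hterm
    _ = θ ^ ((2:ℝ)/3) * (2 / (c * √M)) *
      (D * ∑ k ∈ K, 1 / √(1 + |θ ^ ((2:ℝ)/3) * x - ω (k + 1)|)) := by
        rw [Finset.mul_sum, Finset.mul_sum]
    _ ≤ θ ^ ((2:ℝ)/3) * (2 / (c * √M)) * (D * ((2 * (9 / 4) / ω 1 + 9) * (√M * √M))) := by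
        rw [Real.mul_self_sqrt hM.le]
        have := hsum.trans hsum'
        gcongr
    _ = _ := by field_simp

theorem exists_bound_of_tsupport_subset_Icc {f : ℝ → ℝ} (hf : Continuous f) {a b : ℝ}
    (hs : tsupport f ⊆ Set.Icc a b) : ∃ C > 0, ∀ x, |f x| ≤ C := by
  obtain ⟨C, hC⟩ := hf.bounded_above_of_compact_support
    (HasCompactSupport.of_support_subset_isCompact isCompact_Icc ((subset_tsupport f).trans hs))
  exact ⟨max C 1, by positivity, fun x => (hC x).trans (le_max_left _ _)⟩

theorem mem_Icc_of_tsupport_subset {f : ℝ → ℝ} {s : Set ℝ} (hs : tsupport f ⊆ s) {x : ℝ}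
    (hx : f x ≠ 0) : x ∈ s :=
  hs (subset_tsupport f hx)

theorem half_le_rpow_and_rpow_le {η : ℝ} (hη : η ∈ Set.Icc (1/2 : ℝ) (3/2)) :
    1 / 2 ≤ η ^ ((2:ℝ)/3) ∧ η ^ ((2:ℝ)/3) ≤ 3 / 2 := by
  have hη0 : 0 < η := by linarith [hη.1]
  have h2 : (0 : ℝ) ≤ 2 / 3 := by norm_num
  constructor
  · calc (1 / 2 : ℝ) = (1 / 2) ^ (1 : ℝ) := (Real.rpow_one _).symm
      _ ≤ (1 / 2) ^ ((2:ℝ)/3) :=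
        Real.rpow_le_rpow_of_exponent_ge (by norm_num) (by norm_num) (by norm_num)
      _ ≤ _ := Real.rpow_le_rpow (by norm_num) hη.1 h2
  · calc η ^ ((2:ℝ)/3) ≤ (3 / 2) ^ ((2:ℝ)/3) := Real.rpow_le_rpow hη0.le hη.2 h2
      _ ≤ (3 / 2) ^ (1 : ℝ) :=
        Real.rpow_le_rpow_of_exponent_le (by norm_num) (by norm_num)
      _ = _ := Real.rpow_one _

/-- uniform bound `|G^±_{h,γ}| ≤ C √γ / h²` for the localized Green kernel. -/
theorem green_kernel_sup_bound
    (Ai : ℂ → ℂ)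
    (hAi_diff : Differentiable ℂ Ai)
    (hAi_diff' : Differentiable ℂ (deriv Ai))
    (hAi_ode : ∀ z : ℂ, deriv (deriv Ai) z = z * Ai z)
    (hAi_zero : Ai 0 = (3 : ℂ) ^ (-(2 : ℂ)/3) / Complex.Gamma (2/3))
    (hAi_zero' : deriv Ai 0 = -((3 : ℂ) ^ (-(1 : ℂ)/3)) / Complex.Gamma (1/3))
    (hAi_real : ∀ x : ℝ, (Ai x).im = 0)
    (ω : ℕ → ℝ)
    (hω_pos : 0 < ω 1)
    (hω_mono : StrictMonoOn ω {k | 1 ≤ k})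
    (hω_tendsto : Tendsto ω atTop atTop)
    (hAi_zeros : ∀ x : ℝ, Ai x = 0 ↔ ∃ k : ℕ, 1 ≤ k ∧ x = -ω k)
    (ψ ψ₁ ψ₂ : ℝ → ℝ)
    (hψ : ContDiff ℝ (⊤ : ℕ∞) ψ) (hψs : tsupport ψ ⊆ Set.Icc (1/2 : ℝ) (3/2))
    (hψ₁ : ContDiff ℝ (⊤ : ℕ∞) ψ₁) (hψ₁s : tsupport ψ₁ ⊆ Set.Icc (1/2 : ℝ) (3/2))
    (hψ₂ : ContDiff ℝ (⊤ : ℕ∞) ψ₂) (hψ₂s : tsupport ψ₂ ⊆ Set.Icc (1/2 : ℝ) (3/2)) :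
    ∃ C > 0, ∀ h ∈ Set.Ioc (0:ℝ) 1, ∀ γ ∈ Set.Ioc (0:ℝ) 1,
      ∀ x a : ℝ, 0 < x → 0 < a → ∀ y b t s : ℝ, ∀ sgn : ℝ, sgn = 1 ∨ sgn = -1 →
        ‖GreenKernel Ai ω ψ ψ₁ ψ₂ sgn h γ x y t a b s‖ ≤ C * Real.sqrt γ / h ^ 2 := by

  obtain ⟨C, hC, hsum⟩ := sum_norm_ek_sq_le hAi_diff hAi_diff' hAi_ode hAi_real hω_pos hω_mono
    hAi_zeros
  obtain ⟨P, hP, hψb⟩ := exists_bound_of_tsupport_subset_Icc hψ.continuous hψs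
  obtain ⟨P₁, hP₁, hψ₁b⟩ := exists_bound_of_tsupport_subset_Icc hψ₁.continuous hψ₁s
  obtain ⟨P₂, hP₂, hψ₂b⟩ := exists_bound_of_tsupport_subset_Icc hψ₂.continuous hψ₂s
  refine ⟨P * P₁ * P₂ * (C * (3 / 2)), by positivity, ?_⟩
  rintro h ⟨hh, -⟩ γ ⟨hγ, -⟩ x a hx ha y b t s sgn -
  set H := h ^ ((2:ℝ)/3) with hH_def
  have hH : 0 < H := Real.rpow_pos_of_pos hh _
  set M := γ / H with hM_def
  have hM : 0 < M := by positivity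
  have hMγ : √M * h ^ ((1:ℝ)/3) = √γ := by
    have e : H = (h ^ ((1:ℝ)/3)) ^ 2 := by
      rw [← Real.rpow_natCast, ← Real.rpow_mul hh.le, hH_def]; norm_num
    have hr : 0 < h ^ ((1:ℝ)/3) := Real.rpow_pos_of_pos hh _
    rw [hM_def, e, Real.sqrt_div hγ.le, Real.sqrt_sq hr.le, div_mul_cancel₀ _ hr.ne']
  have hHh : H * h ^ ((1:ℝ)/3) = h := by
    rw [hH_def, ← Real.rpow_add hh]; norm_num
  have hfin : {k : ℕ | M / 4 ≤ ω (k + 1) ∧ ω (k + 1) ≤ 9 / 4 * M}.Finite := by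
    have h1 := (hω_tendsto.comp (tendsto_add_atTop_nat 1)).eventually_gt_atTop (9 / 4 * M)
    rw [← Nat.cofinite_eq_atTop, eventually_cofinite] at h1
    exact h1.subset fun k hk => not_lt.2 hk.2
  set K := hfin.toFinset with hK
  have hψ₂K : ∀ k η, η ∈ Set.Icc (1/2 : ℝ) (3/2) →
      ψ₂ (H * ω (k+1) / (η ^ ((2:ℝ)/3) * γ)) ≠ 0 → k ∈ K := by
    intro k η hη hne
    obtain ⟨h1, h2⟩ := mem_Icc_of_tsupport_subset hψ₂s hne
    obtain ⟨h3, h4⟩ := half_le_rpow_and_rpow_le hη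
    have h5 : 0 < η ^ ((2:ℝ)/3) * γ := by positivity
    rw [le_div_iff₀ h5] at h1
    rw [div_le_iff₀ h5] at h2
    rw [hK, Set.Finite.mem_toFinset]
    have e : M * H = γ := div_mul_cancel₀ _ hH.ne'
    have h6 := mul_le_mul_of_nonneg_right h3 hγ.le
    have h7 := mul_le_mul_of_nonneg_right h4 hγ.le
    constructor
    · refine le_of_mul_le_mul_right ?_ hH
      linarith
    · refine le_of_mul_le_mul_right ?_ hH
      linarith
  set f : ℕ → ℝ → ℂ := fun k η =>
    Complex.exp (Complex.I * ((sgn * (t - s) * Real.sqrt (lamk ω (k+1) (η/h)) : ℝ) : ℂ)) *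
    Complex.exp (Complex.I * (((y - b) * η / h : ℝ) : ℂ)) *
    ((ψ η * ψ₁ (h * Real.sqrt (lamk ω (k+1) (η/h)))
        * ψ₂ (H * ω (k+1) / (η ^ ((2:ℝ)/3) * γ)) : ℝ) : ℂ) *
    ek Ai ω (k+1) (η/h) x * ek Ai ω (k+1) (η/h) a with hf
  have hG : GreenKernel Ai ω ψ ψ₁ ψ₂ sgn h γ x y t a b s =
      ∑' k : ℕ, ((1/h : ℝ) : ℂ) * ∫ η : ℝ, f k η := rfl
  have hf0 : ∀ k ∉ K, ∀ η, f k η = 0 := by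
    intro k hk η
    have : ψ η * ψ₁ (h * Real.sqrt (lamk ω (k+1) (η/h)))
        * ψ₂ (H * ω (k+1) / (η ^ ((2:ℝ)/3) * γ)) = 0 := by
      by_cases h1 : ψ η = 0
      · simp [h1]
      · have : ψ₂ (H * ω (k+1) / (η ^ ((2:ℝ)/3) * γ)) = 0 := by
          by_contra h2
          exact hk (hψ₂K k η (mem_Icc_of_tsupport_subset hψs h1) h2)
        simp [this]
    simp only [hf, this, Complex.ofReal_zero, mul_zero, zero_mul]
  have hfn : ∀ k η, ‖f k η‖ ≤ P * P₁ * P₂ *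
      ((‖ek Ai ω (k+1) (η/h) x‖ ^ 2 + ‖ek Ai ω (k+1) (η/h) a‖ ^ 2) / 2) := by
    intro k η
    simp only [hf, norm_mul, Complex.norm_exp_I_mul_ofReal, one_mul, Complex.norm_real,
      Real.norm_eq_abs]
    rw [mul_assoc]
    refine mul_le_mul ?_ ?_ (by positivity) (by positivity)
    · have h1 := hψb η
      have h2 := hψ₁b (h * Real.sqrt (lamk ω (k+1) (η/h)))
      have h3 := hψ₂b (H * ω (k+1) / (η ^ ((2:ℝ)/3) * γ))
      gcongr
    · nlinarith [sq_nonneg (‖ek Ai ω (k+1) (η/h) x‖ - ‖ek Ai ω (k+1) (η/h) a‖)]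
  set B := P * P₁ * P₂ * (C * (3 / 2)) * √γ / h with hB
  have hB0 : 0 ≤ B := by positivity
  have hfB : ∀ η, ∑ k ∈ K, ‖f k η‖ ≤ (Set.Icc (1/2 : ℝ) (3/2)).indicator (fun _ => B) η := by
    intro η
    by_cases hη : η ∈ Set.Icc (1/2 : ℝ) (3/2)
    · rw [Set.indicator_of_mem hη]
      have hη0 : 0 < η := by linarith [hη.1]
      have hKm : ∀ k ∈ K, M / 4 ≤ ω (k + 1) ∧ ω (k + 1) ≤ 9 / 4 * M := fun k hk =>
        hfin.mem_toFinset.1 hk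
      have h1 := hsum M hM K hKm (η / h) (by positivity) x hx.le
      have h2 := hsum M hM K hKm (η / h) (by positivity) a ha.le
      have h3 : (η / h) ^ ((2:ℝ)/3) * √M ≤ 3 / 2 * (√γ / h) := by
        have e : √M / H = √γ / h := by
          rw [div_eq_div_iff hH.ne' hh.ne', ← hHh]
          linear_combination H * hMγ
        rw [Real.div_rpow hη0.le hh.le, ← e]
        calc _ = η ^ ((2:ℝ)/3) * (√M / H) := by rw [hH_def]; ring
          _ ≤ _ := mul_le_mul_of_nonneg_right (half_le_rpow_and_rpow_le hη).2 (by positivity)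
      calc _ ≤ ∑ k ∈ K, P * P₁ * P₂ *
            ((‖ek Ai ω (k+1) (η/h) x‖ ^ 2 + ‖ek Ai ω (k+1) (η/h) a‖ ^ 2) / 2) :=
            Finset.sum_le_sum fun k _ => hfn k η
        _ = P * P₁ * P₂ * ((∑ k ∈ K, ‖ek Ai ω (k+1) (η/h) x‖ ^ 2 +
            ∑ k ∈ K, ‖ek Ai ω (k+1) (η/h) a‖ ^ 2) / 2) := by
            rw [← Finset.mul_sum, ← Finset.sum_div, Finset.sum_add_distrib]
        _ ≤ P * P₁ * P₂ * (C * (3 / 2 * (√γ / h))) := by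
            refine mul_le_mul_of_nonneg_left ?_ (by positivity)
            have := mul_le_mul_of_nonneg_left h3 hC.le
            linarith
        _ = B := by rw [hB]; ring
    · rw [Set.indicator_of_notMem hη]
      have h1 : ψ η = 0 := by
        by_contra h1
        exact hη (mem_Icc_of_tsupport_subset hψs h1)
      simp [hf, h1]
  have hmain := sum_norm_integral_le (μ := volume) K f
    ((integrable_indicator_iff measurableSet_Icc).2 (integrableOn_const (by simp))) hfB
  have hI : ∫ η, (Set.Icc (1/2 : ℝ) (3/2)).indicator (fun _ => B) η = B := by
    rw [integral_indicator measurableSet_Icc, setIntegral_const]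
    norm_num
  rw [hI] at hmain
  rw [hG, tsum_eq_sum (s := K) fun k hk => by simp [hf0 k hk], ← Finset.mul_sum, norm_mul,
    Complex.norm_real, Real.norm_eq_abs, abs_of_pos (one_div_pos.2 hh)]
  calc _ ≤ 1 / h * B := mul_le_mul_of_nonneg_left
        ((norm_sum_le _ _).trans hmain) (by positivity)
    _ = _ := by rw [hB]; field_simp
end

section
/- There exist δ ∈ (0,1/2), a₀ ∈ (0,1) and a constant C with the following properties. For every K ∈ [1−δ, 1+δ], w ∈ [−δ,δ] and a ∈ [0,a₀] there is a unique A ∈ [1/4, 4] with √A = K√((1+a)/(1+aA)) − w; denote it A_c(K,w,a). The function A_c is smooth in (K,w,a); at w = 0 one has √(A_c(K,0,a)) = K_∞(a,K) where K_∞(a,K) := K√(2(1+a)/(1+√(1+4K²a(1+a)))); for each fixed a ∈ [0,a₀] the map K ↦ K_∞(a,K) is a smooth, strictly monotone bijection from [1−δ,1+δ] onto its image with |K_∞(a,K) − 1 − (K−1)| ≤ C a |K−1|; and |√(A_c(K,w,a)) − K_∞(a,K) + w| ≤ C a |w| (i.e. √(A_c) = K_∞ − w(1 − aℰ) for a smooth,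 uniformly bounded function ℰ). -/
open Real Set

/-- `K_∞(a,K)` from the statement. -/
noncomputable def Kinf (a K : ℝ) : ℝ :=
  K * Real.sqrt (2 * (1 + a) / (1 + Real.sqrt (1 + 4 * K ^ 2 * a * (1 + a))))

/-- Scalar implicit function theorem: a smooth equation whose partial derivative in the last
variable does not vanish has a smooth local solution. -/
theorem exists_contDiffAt_implicit {E : Type*} [NormedAddCommGroup E] [NormedSpace ℝ E]
    [CompleteSpace E] {n : WithTop ℕ∞} (hn : n ≠ 0) {f : E × ℝ → ℝ} {u : E × ℝ} {c : ℝ}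
    (hf : ContDiffAt ℝ n f u) (hc : HasDerivAt (fun x => f (u.1, x)) c u.2) (hc0 : c ≠ 0) :
    ∃ ψ : E → ℝ, ContDiffAt ℝ n ψ u.1 ∧ ψ u.1 = u.2 ∧ ∀ᶠ p in nhds u.1, f (p, ψ p) = f u := by
  have hd : HasFDerivAt f (fderiv ℝ f u) u := (hf.differentiableAt hn).hasFDerivAt
  have hpartial : (fderiv ℝ f u ∘L .inr ℝ E ℝ) 1 = c :=
    ((hd.comp u.2 (hasFDerivAt_prodMk_right u.1 u.2)).hasDerivAt).unique hc
  have hinv : (fderiv ℝ f u ∘L .inr ℝ E ℝ).IsInvertible := by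
    refine ⟨ContinuousLinearEquiv.unitsEquivAut ℝ (Units.mk0 c hc0), ?_⟩
    ext
    rw [hpartial]
    simp
  exact ⟨hf.implicitFunction hn hinv, hf.contDiffAt_implicitFunction hn hinv,
    hf.implicitFunction_apply_self hn hinv, hf.eventually_apply_implicitFunction hn hinv⟩

/-- The critical point equation for `x = √A`, squared and cleared of denominators. -/
theorem eq_mul_sqrt_sub_iff {K w a x : ℝ} (hK : 0 < K) (ha : 0 ≤ a) (hxw : 0 < x + w) :
    x = K * √((1 + a) / (1 + a * x ^ 2)) - w ↔
      (x + w) ^ 2 * (1 + a * x ^ 2) = K ^ 2 * (1 + a) := by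
  have hpos : 0 < 1 + a * x ^ 2 := by positivity
  have hq : 0 ≤ (1 + a) / (1 + a * x ^ 2) := by positivity
  rw [← eq_div_iff hpos.ne', mul_div_assoc]
  nth_rewrite 2 [← Real.sq_sqrt hq]
  rw [← mul_pow, pow_left_inj₀ hxw.le (by positivity) two_ne_zero, eq_sub_iff_add_eq]

theorem sq_mul_lt_of_lt {w a x y : ℝ} (ha : 0 ≤ a) (hx : 0 < x) (hxw : 0 < x + w)
    (hxy : x < y) :
    (x + w) ^ 2 * (1 + a * x ^ 2) < (y + w) ^ 2 * (1 + a * y ^ 2) := by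
  have h : (x + w) ^ 2 < (y + w) ^ 2 := by gcongr
  have h' : 1 + a * x ^ 2 ≤ 1 + a * y ^ 2 := by gcongr
  exact mul_lt_mul h h' (by positivity) (by positivity)

theorem eq_of_sq_mul_eq {w a x y : ℝ} (ha : 0 ≤ a) (hx : 0 < x) (hxw : 0 < x + w)
    (hy : 0 < y) (hyw : 0 < y + w)
    (h : (x + w) ^ 2 * (1 + a * x ^ 2) = (y + w) ^ 2 * (1 + a * y ^ 2)) : x = y := by
  rcases lt_trichotomy x y with hxy | hxy | hxy
  · exact absurd h (sq_mul_lt_of_lt ha hx hxw hxy).ne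
  · exact hxy
  · exact absurd h (sq_mul_lt_of_lt ha hy hyw hxy).ne'

theorem exists_sq_mul_eq {K w a : ℝ} (hK : K ∈ Icc (1 - 1 / 8 : ℝ) (1 + 1 / 8))
    (hw : w ∈ Icc (-(1 / 8) : ℝ) (1 / 8)) (ha : a ∈ Icc (0 : ℝ) (1 / 8)) :
    ∃ x ∈ Ioo (1 / 2 : ℝ) 2, (x + w) ^ 2 * (1 + a * x ^ 2) = K ^ 2 * (1 + a) := by
  obtain ⟨hK1, hK2⟩ := hK
  obtain ⟨hw1, hw2⟩ := hw
  obtain ⟨ha1, ha2⟩ := ha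
  have hcont : ContinuousOn (fun x : ℝ => (x + w) ^ 2 * (1 + a * x ^ 2)) (Icc (1 / 2) 2) := by
    fun_prop
  have hKl : (7 / 8 : ℝ) ^ 2 ≤ K ^ 2 := by gcongr; linarith
  have hKu : K ^ 2 ≤ (9 / 8 : ℝ) ^ 2 := by gcongr; linarith
  have hwl : (1 / 2 + w) ^ 2 ≤ (5 / 8 : ℝ) ^ 2 := by gcongr <;> linarith
  have hwu : (15 / 8 : ℝ) ^ 2 ≤ (2 + w) ^ 2 := by gcongr; linarith
  refine intermediate_value_Ioo (by norm_num) hcont ⟨?_, ?_⟩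
  · calc (1 / 2 + w) ^ 2 * (1 + a * (1 / 2) ^ 2)
        ≤ (5 / 8 : ℝ) ^ 2 * (1 + a * (1 / 2) ^ 2) := by gcongr
      _ < (7 / 8 : ℝ) ^ 2 * (1 + a) := by linarith
      _ ≤ K ^ 2 * (1 + a) := by gcongr
  · calc K ^ 2 * (1 + a) ≤ (9 / 8 : ℝ) ^ 2 * (1 + a) := by gcongr
      _ < (15 / 8 : ℝ) ^ 2 * (1 + a * 2 ^ 2) := by linarith
      _ ≤ (2 + w) ^ 2 * (1 + a * 2 ^ 2) := by gcongr

theorem Kinf_pos {a K : ℝ} (ha : 0 ≤ a) (hK : 0 < K) : 0 < Kinf a K := by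
  unfold Kinf
  positivity

theorem Kinf_sq_mul {a K : ℝ} (ha : 0 ≤ a) :
    Kinf a K ^ 2 * (1 + a * Kinf a K ^ 2) = K ^ 2 * (1 + a) := by
  have hs : √(1 + 4 * K ^ 2 * a * (1 + a)) ^ 2 = 1 + 4 * K ^ 2 * a * (1 + a) :=
    Real.sq_sqrt (by positivity)
  have hs0 : 0 < 1 + √(1 + 4 * K ^ 2 * a * (1 + a)) := by positivity
  rw [Kinf, mul_pow, Real.sq_sqrt (by positivity)]
  generalize √(1 + 4 * K ^ 2 * a * (1 + a)) = s at *
  field_simp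
  linear_combination (-K ^ 2) * hs

theorem strictMonoOn_Kinf {a : ℝ} (ha : 0 ≤ a) : StrictMonoOn (Kinf a) (Ioi 0) := by
  intro K hK L hL hKL
  rw [mem_Ioi] at hK hL
  by_contra! h
  have hle : Kinf a L ^ 2 * (1 + a * Kinf a L ^ 2) ≤ Kinf a K ^ 2 * (1 + a * Kinf a K ^ 2) := by
    have := Kinf_pos ha hL
    gcongr
  rw [Kinf_sq_mul ha, Kinf_sq_mul ha] at hle
  have : K ^ 2 * (1 + a) < L ^ 2 * (1 + a) := by gcongr
  linarith

theorem contDiff_Kinf {a : ℝ} (ha : 0 ≤ a) {n : WithTop ℕ∞} : ContDiff ℝ n (Kinf a) := by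
  unfold Kinf
  have h1 : ContDiff ℝ n fun K : ℝ => √(1 + 4 * K ^ 2 * a * (1 + a)) :=
    ContDiff.sqrt (by fun_prop) fun K => by positivity
  refine contDiff_id.mul (ContDiff.sqrt (contDiff_const.div (contDiff_const.add h1) fun K => ?_)
    fun K => ?_) <;> positivity

/-- A bound on the difference of two squares bounds the difference of the numbers themselves when
their sum is bounded below. -/
theorem abs_sub_le_of_abs_sq_sub_sq_le {x y b : ℝ} (hxy : 1 / 2 ≤ x + y)
    (h : |x ^ 2 - y ^ 2| ≤ b) : |x - y| ≤ 2 * b := by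
  have : x ^ 2 - y ^ 2 = (x - y) * (x + y) := by ring
  rw [this, abs_mul, abs_of_pos (by linarith : 0 < x + y)] at h
  nlinarith [abs_nonneg (x - y)]

theorem abs_sub_le_of_sq_mul_eq {K a y : ℝ} (ha : 0 ≤ a) (hK : K ∈ Icc (1 / 2 : ℝ) 2)
    (hy : y ∈ Icc (1 / 2 : ℝ) 2) (h : y ^ 2 * (1 + a * y ^ 2) = K ^ 2 * (1 + a)) :
    |y - K| ≤ 36 * a * |K - 1| := by
  obtain ⟨hK1, hK2⟩ := hK
  obtain ⟨hy1, hy2⟩ := hy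
  have hy4 : y ^ 2 ≤ 4 := by nlinarith
  have hsq : |y ^ 2 - 1| ≤ |K ^ 2 - 1| := by
    have e : (y ^ 2 - 1) * (1 + a * (y ^ 2 + 1)) = (K ^ 2 - 1) * (1 + a) := by
      linear_combination h
    have e' := congrArg abs e
    rw [abs_mul, abs_mul, abs_of_pos (by positivity : 0 < 1 + a * (y ^ 2 + 1)),
      abs_of_pos (by positivity : 0 < 1 + a)] at e'
    have : |y ^ 2 - 1| * (1 + a) ≤ |K ^ 2 - 1| * (1 + a) := by
      rw [← e']
      gcongr
      nlinarith [mul_nonneg ha (sq_nonneg y)]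
    exact le_of_mul_le_mul_right this (by positivity)
  have hK' : |K ^ 2 - 1| ≤ 3 * |K - 1| := by
    have : K ^ 2 - 1 = (K + 1) * (K - 1) := by ring
    rw [this, abs_mul, abs_of_pos (by linarith : 0 < K + 1)]
    gcongr
    linarith
  suffices h' : |y ^ 2 - K ^ 2| ≤ 18 * a * |K - 1| by
    linarith [abs_sub_le_of_abs_sq_sub_sq_le (by linarith) h']
  calc |y ^ 2 - K ^ 2| = |a * ((K ^ 2 - 1) - (y ^ 2 + 1) * (y ^ 2 - 1))| := by
        congr 1
        linear_combination h
    _ ≤ a * (|K ^ 2 - 1| + (y ^ 2 + 1) * |y ^ 2 - 1|) := by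
        rw [abs_mul, abs_of_nonneg ha]
        gcongr
        refine (abs_sub _ _).trans_eq ?_
        rw [abs_mul, abs_of_pos (by positivity : 0 < y ^ 2 + 1)]
    _ ≤ a * (3 * |K - 1| + (4 + 1) * (3 * |K - 1|)) := by
        gcongr
        exact hsq.trans hK'
    _ = 18 * a * |K - 1| := by ring

theorem abs_add_sub_le_of_sq_mul_eq {w a x y : ℝ} (ha : 0 ≤ a) (hx : x ∈ Icc (1 / 2 : ℝ) 2)
    (hy : y ∈ Icc (1 / 2 : ℝ) 2) (hxw : x + w ∈ Icc 0 3)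
    (h : (x + w) ^ 2 * (1 + a * x ^ 2) = y ^ 2 * (1 + a * y ^ 2)) :
    |x + w - y| ≤ 60 * a * |w| := by
  obtain ⟨hx1, hx2⟩ := hx
  obtain ⟨hy1, hy2⟩ := hy
  obtain ⟨hu1, hu2⟩ := hxw
  set u := x + w with hu
  have hw : w = u - x := by rw [hu]; ring
  have hm : 0 ≤ y ^ 2 + u * x := by positivity
  have hm' : y ^ 2 + u * x ≤ 10 := by nlinarith
  suffices hsq : |u ^ 2 - y ^ 2| ≤ 30 * a * |w| by
    linarith [abs_sub_le_of_abs_sq_sub_sq_le (by linarith) hsq]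
  have e : (u ^ 2 - y ^ 2) * (1 + a * (y ^ 2 + u * x)) = a * (u * (w * (y ^ 2 + u * x))) := by
    rw [hw]
    linear_combination h
  have e' := congrArg abs e
  rw [abs_mul, abs_mul, abs_mul, abs_mul, abs_of_nonneg ha, abs_of_nonneg hu1, abs_of_nonneg hm,
    abs_of_pos (by positivity : 0 < 1 + a * (y ^ 2 + u * x))] at e'
  calc |u ^ 2 - y ^ 2| ≤ |u ^ 2 - y ^ 2| * (1 + a * (y ^ 2 + u * x)) :=
        le_mul_of_one_le_right (abs_nonneg _) (le_add_of_nonneg_right (by positivity))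
    _ = a * (u * (|w| * (y ^ 2 + u * x))) := e'
    _ ≤ a * (3 * (|w| * 10)) := by gcongr
    _ = 30 * a * |w| := by ring

/-- A function selecting the root of the squared critical point equation in `(1/2, 2)` is
smooth. -/
theorem contDiffOn_of_sq_mul_eq {X : ℝ → ℝ → ℝ → ℝ} {s : Set (ℝ × ℝ × ℝ)}
    (hs : ∀ p ∈ s, 0 ≤ p.2.2 ∧ -(1 / 2) < p.2.1)
    (hX : ∀ p ∈ s, X p.1 p.2.1 p.2.2 ∈ Ioo (1 / 2 : ℝ) 2 ∧
      (X p.1 p.2.1 p.2.2 + p.2.1) ^ 2 * (1 + p.2.2 * X p.1 p.2.1 p.2.2 ^ 2) =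
        p.1 ^ 2 * (1 + p.2.2)) {n : WithTop ℕ∞} (hn : n ≠ 0) :
    ContDiffOn ℝ n (fun p : ℝ × ℝ × ℝ => X p.1 p.2.1 p.2.2) s := by
  rintro ⟨K, w, a⟩ hp
  obtain ⟨ha, hw⟩ := hs _ hp
  obtain ⟨⟨hx1, hx2⟩, hx⟩ := hX _ hp
  dsimp only at ha hw hx1 hx2 hx
  set x := X K w a with hxdef
  let f : (ℝ × ℝ × ℝ) × ℝ → ℝ := fun q =>
    (q.2 + q.1.2.1) ^ 2 * (1 + q.1.2.2 * q.2 ^ 2) - q.1.1 ^ 2 * (1 + q.1.2.2)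
  have hf : ContDiffAt ℝ n f ((K, w, a), x) := by
    have : ContDiff ℝ n f := by fun_prop
    exact this.contDiffAt
  have hf0 : f ((K, w, a), x) = 0 := sub_eq_zero.2 hx
  have hd : HasDerivAt (fun t => f ((K, w, a), t))
      (2 * (x + w) * (1 + a * x ^ 2) + (x + w) ^ 2 * (a * (2 * x))) x := by
    have h := ((((hasDerivAt_id x).add_const w).pow 2).mul
      ((((hasDerivAt_id x).pow 2).const_mul a).const_add 1)).sub_const (K ^ 2 * (1 + a))
    convert! h using 1
    simp
  have hxw : 0 < x + w := by linarith
  have hx0 : 0 < x := by linarith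
  obtain ⟨ψ, hψ, hψx, hψf⟩ := exists_contDiffAt_implicit hn hf hd (by positivity)
  dsimp only at hψ hψx hψf
  have hψmem : ∀ᶠ p in nhds (K, w, a), ψ p ∈ Ioo (1 / 2 : ℝ) 2 :=
    hψ.continuousAt.eventually (by rw [hψx]; exact Ioo_mem_nhds hx1 hx2)
  refine hψ.contDiffWithinAt.congr_of_eventuallyEq ?_ hψx.symm
  filter_upwards [mem_nhdsWithin_of_mem_nhds hψf, mem_nhdsWithin_of_mem_nhds hψmem,
    self_mem_nhdsWithin] with p hpf hpm hps
  obtain ⟨ha', hw'⟩ := hs p hps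
  obtain ⟨⟨hy1, hy2⟩, hy⟩ := hX p hps
  rw [hf0, sub_eq_zero] at hpf
  exact eq_of_sq_mul_eq ha' (by linarith) (by linarith) (by linarith [hpm.1])
    (by linarith [hpm.1]) (hy.trans hpf.symm)

/-- existence, uniqueness, smoothness and asymptotics of the critical point
`A_c(K,w,a)` of the phase, solving `√A = K √((1+a)/(1+aA)) − w`. -/
theorem critical_point_Ac :
    ∃ δ ∈ Set.Ioo (0:ℝ) (1/2), ∃ a₀ ∈ Set.Ioo (0:ℝ) 1, ∃ C : ℝ, ∃ Ac : ℝ → ℝ → ℝ → ℝ,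
      -- existence and uniqueness of the solution in [1/4,4]
      (∀ K ∈ Set.Icc (1-δ) (1+δ), ∀ w ∈ Set.Icc (-δ) δ, ∀ a ∈ Set.Icc (0:ℝ) a₀,
        (Ac K w a ∈ Set.Icc (1/4 : ℝ) 4 ∧
          Real.sqrt (Ac K w a) = K * Real.sqrt ((1 + a) / (1 + a * Ac K w a)) - w) ∧
        (∀ A ∈ Set.Icc (1/4 : ℝ) 4,
          Real.sqrt A = K * Real.sqrt ((1 + a) / (1 + a * A)) - w → A = Ac K w a)) ∧
      -- smoothness of A_c in (K,w,a)
      ContDiffOn ℝ (⊤ : ℕ∞) (fun p : ℝ × ℝ × ℝ => Ac p.1 p.2.1 p.2.2)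
        (Set.Icc (1-δ) (1+δ) ×ˢ Set.Icc (-δ) δ ×ˢ Set.Icc (0:ℝ) a₀) ∧
      -- value at w = 0
      (∀ K ∈ Set.Icc (1-δ) (1+δ), ∀ a ∈ Set.Icc (0:ℝ) a₀,
        Real.sqrt (Ac K 0 a) = Kinf a K) ∧
      -- K ↦ K_∞(a,K) is a smooth strictly monotone (hence bijective onto its image) map
      (∀ a ∈ Set.Icc (0:ℝ) a₀,
        ContDiffOn ℝ (⊤ : ℕ∞) (fun K => Kinf a K) (Set.Icc (1-δ) (1+δ)) ∧
        StrictMonoOn (fun K => Kinf a K) (Set.Icc (1-δ) (1+δ))) ∧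
      (∀ K ∈ Set.Icc (1-δ) (1+δ), ∀ a ∈ Set.Icc (0:ℝ) a₀,
        |Kinf a K - 1 - (K - 1)| ≤ C * a * |K - 1|) ∧
      -- √(A_c) = K_∞ − w (1 − a ℰ) with ℰ uniformly bounded
      (∀ K ∈ Set.Icc (1-δ) (1+δ), ∀ w ∈ Set.Icc (-δ) δ, ∀ a ∈ Set.Icc (0:ℝ) a₀,
        |Real.sqrt (Ac K w a) - Kinf a K + w| ≤ C * a * |w|) := by
  have hex : ∀ K w a : ℝ, ∃ x : ℝ, K ∈ Icc (1 - 1 / 8 : ℝ) (1 + 1 / 8) →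
      w ∈ Icc (-(1 / 8) : ℝ) (1 / 8) → a ∈ Icc (0 : ℝ) (1 / 8) →
      x ∈ Ioo (1 / 2 : ℝ) 2 ∧ (x + w) ^ 2 * (1 + a * x ^ 2) = K ^ 2 * (1 + a) := by
    intro K w a
    by_cases h : K ∈ Icc (1 - 1 / 8 : ℝ) (1 + 1 / 8) ∧ w ∈ Icc (-(1 / 8) : ℝ) (1 / 8) ∧
        a ∈ Icc (0 : ℝ) (1 / 8)
    · obtain ⟨x, hx⟩ := exists_sq_mul_eq h.1 h.2.1 h.2.2
      exact ⟨x, fun _ _ _ => hx⟩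
    · exact ⟨0, fun h1 h2 h3 => absurd ⟨h1, h2, h3⟩ h⟩
  choose X hX using hex
  have hsqrt : ∀ K ∈ Icc (1 - 1 / 8 : ℝ) (1 + 1 / 8), ∀ w ∈ Icc (-(1 / 8) : ℝ) (1 / 8),
      ∀ a ∈ Icc (0 : ℝ) (1 / 8), √(X K w a ^ 2) = X K w a := fun K hK w hw a ha =>
    Real.sqrt_sq (by linarith [(hX K w a hK hw ha).1.1])
  have hzero : (0 : ℝ) ∈ Icc (-(1 / 8) : ℝ) (1 / 8) := by norm_num
  have hXzero : ∀ K ∈ Icc (1 - 1 / 8 : ℝ) (1 + 1 / 8), ∀ a ∈ Icc (0 : ℝ) (1 / 8),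
      X K 0 a = Kinf a K := by
    intro K hK a ha
    obtain ⟨⟨hx1, hx2⟩, hx⟩ := hX K 0 a hK hzero ha
    have hpos := Kinf_pos ha.1 (by linarith [hK.1] : 0 < K)
    refine eq_of_sq_mul_eq (w := 0) ha.1 (by linarith) (by linarith) hpos (by linarith)
      (hx.trans ?_)
    rw [add_zero, Kinf_sq_mul ha.1]
  have hKinf : ∀ K ∈ Icc (1 - 1 / 8 : ℝ) (1 + 1 / 8), ∀ a ∈ Icc (0 : ℝ) (1 / 8),
      Kinf a K ∈ Icc (1 / 2 : ℝ) 2 := fun K hK a ha =>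
    hXzero K hK a ha ▸ Ioo_subset_Icc_self (hX K 0 a hK hzero ha).1
  refine ⟨1 / 8, by norm_num, 1 / 8, by norm_num, 60, fun K w a => X K w a ^ 2,
    ?_, ?_, ?_, ?_, ?_, ?_⟩
  · intro K hK w hw a ha
    obtain ⟨⟨hx1, hx2⟩, hx⟩ := hX K w a hK hw ha
    have hK0 : 0 < K := by linarith [hK.1]
    refine ⟨⟨⟨by nlinarith, by nlinarith⟩, ?_⟩, ?_⟩
    · rw [hsqrt K hK w hw a ha]
      exact (eq_mul_sqrt_sub_iff hK0 ha.1 (by linarith [hw.1])).2 hx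
    · intro A hA h
      have hA0 : 0 ≤ A := by linarith [hA.1]
      have hx' : 1 / 2 ≤ √A := Real.le_sqrt_of_sq_le (by linarith [hA.1])
      have hAw : 0 < √A + w := by linarith [hw.1]
      nth_rewrite 2 [← Real.sq_sqrt hA0] at h
      rw [eq_mul_sqrt_sub_iff hK0 ha.1 hAw] at h
      have := eq_of_sq_mul_eq ha.1 (by linarith) hAw (by linarith) (by linarith [hw.1])
        (h.trans hx.symm)
      dsimp only
      rw [← this, Real.sq_sqrt hA0]
  · refine ContDiffOn.pow (contDiffOn_of_sq_mul_eq ?_ ?_ (by simp)) 2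
    · rintro ⟨K, w, a⟩ ⟨-, hw, ha⟩
      exact ⟨ha.1, by linarith [hw.1]⟩
    · rintro ⟨K, w, a⟩ ⟨hK, hw, ha⟩
      exact hX K w a hK hw ha
  · intro K hK a ha
    rw [hsqrt K hK 0 hzero a ha, hXzero K hK a ha]
  · intro a ha
    refine ⟨(contDiff_Kinf ha.1).contDiffOn, (strictMonoOn_Kinf ha.1).mono fun K hK => ?_⟩
    rw [mem_Ioi]
    linarith [hK.1]
  · intro K hK a ha
    rw [sub_sub, add_sub_cancel]
    refine (abs_sub_le_of_sq_mul_eq ha.1 ⟨by linarith [hK.1], by linarith [hK.2]⟩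
      (hKinf K hK a ha) (Kinf_sq_mul ha.1)).trans ?_
    have := ha.1
    gcongr
    norm_num
  · intro K hK w hw a ha
    obtain ⟨⟨hx1, hx2⟩, hx⟩ := hX K w a hK hw ha
    have hy := hKinf K hK a ha
    rw [hsqrt K hK w hw a ha, sub_add_eq_add_sub]
    exact abs_add_sub_le_of_sq_mul_eq ha.1 ⟨hx1.le, hx2.le⟩ hy
      ⟨by linarith [hw.1], by linarith [hw.2]⟩ (hx.trans (Kinf_sq_mul ha.1).symm)
end
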